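/- Let d ≥ 1 and let a, b ∈ ℝ. There is no C¹ curve γ : [0,1] → ℝ^{d+1}, written γ = (γ₀, γ₁, …, γ_d), with γ(0) = (sinh a, cosh a, 0, …, 0) and γ(1) = (sinh b, −cosh b, 0, …, 0), such that γ₀′(s)² > γ₁′(s)² + ⋯ + γ_d′(s)² for every s ∈ [0,1]. Equivalently, no point of the hyperbola branch {(t, x₁, …, x_d) : x₁ = √(1+t²), x₂ = ⋯ = x_d = 0} can be joined to any point of the branch {x₁ = −√(1+t²), x₂ = ⋯ = x_d = 0} by a timelike curve in (d+1)-dimensional Minkowski space. -/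

import Mathlib

open Real

/-- If the derivative of `g` is strictly dominated by that of `f` on `[u, v]`, then the
increment of `g` is bounded by that of `f`. -/
theorem sq_sub_le_sq_sub_of_sq_deriv_lt {f f' g g' : ℝ → ℝ} {u v : ℝ} (huv : u < v)
    (hf : ∀ s ∈ Set.Icc u v, HasDerivWithinAt f (f' s) (Set.Icc u v) s)
    (hg : ∀ s ∈ Set.Icc u v, HasDerivWithinAt g (g' s) (Set.Icc u v) s)
    (hlt : ∀ s ∈ Set.Icc u v, g' s ^ 2 < f' s ^ 2) :
    (g v - g u) ^ 2 ≤ (f v - f u) ^ 2 := by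
  obtain ⟨c, hc, h⟩ := exists_ratio_hasDerivAt_eq_ratio_slope f f' huv
    (fun s hs => (hf s hs).continuousWithinAt)
    (fun s hs => (hf s (Set.Ioo_subset_Icc_self hs)).hasDerivAt (Icc_mem_nhds hs.1 hs.2))
    g g' (fun s hs => (hg s hs).continuousWithinAt)
    (fun s hs => (hg s (Set.Ioo_subset_Icc_self hs)).hasDerivAt (Icc_mem_nhds hs.1 hs.2))
  have hlt := hlt c (Set.Ioo_subset_Icc_self hc)
  have hpos : 0 < f' c ^ 2 := (sq_nonneg _).trans_lt hlt
  refine le_of_mul_le_mul_right ?_ hpos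
  calc (g v - g u) ^ 2 * f' c ^ 2 = (f v - f u) ^ 2 * g' c ^ 2 := by
        rw [← mul_pow, h, mul_pow]
    _ ≤ (f v - f u) ^ 2 * f' c ^ 2 := by gcongr

/-- The Penrose property fails for Minkowski spacetime in `d+1` dimensions:
no C¹ timelike curve (with respect to the metric `dt² - dx₁² - ⋯ - dx_d²`,
coordinate `0` being time) joins the point `(sinh a, cosh a, 0, …, 0)` on one
branch of the hyperbola `x₁² - t² = 1` to the point `(sinh b, -cosh b, 0, …, 0)`
on the other branch. -/
theorem no_timelike_curve_between_hyperbola_branches (d : ℕ) (hd : 1 ≤ d) (a b : ℝ) :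
    ¬ ∃ γ γ' : ℝ → Fin (d + 1) → ℝ,
      (∀ s ∈ Set.Icc (0 : ℝ) 1, HasDerivWithinAt γ (γ' s) (Set.Icc (0 : ℝ) 1) s) ∧
      ContinuousOn γ' (Set.Icc (0 : ℝ) 1) ∧
      (γ 0 = fun i => if i = 0 then Real.sinh a else if i = 1 then Real.cosh a else 0) ∧
      (γ 1 = fun i => if i = 0 then Real.sinh b else if i = 1 then -Real.cosh b else 0) ∧
      (∀ s ∈ Set.Icc (0 : ℝ) 1,
        (∑ i ∈ Finset.univ.erase (0 : Fin (d + 1)), (γ' s i) ^ 2) < (γ' s 0) ^ 2) := by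
  rintro ⟨γ, γ', hγ, -, h0, h1, ht⟩
  have hne : (1 : Fin (d + 1)) ≠ 0 := by
    obtain ⟨n, rfl⟩ := Nat.exists_eq_add_of_le' hd
    exact one_ne_zero
  have hcoord (i : Fin (d + 1)) : ∀ s ∈ Set.Icc (0 : ℝ) 1,
      HasDerivWithinAt (fun s => γ s i) (γ' s i) (Set.Icc (0 : ℝ) 1) s :=
    fun s hs => hasDerivWithinAt_pi.1 (hγ s hs) i
  have hlt : ∀ s ∈ Set.Icc (0 : ℝ) 1, γ' s 1 ^ 2 < γ' s 0 ^ 2 := fun s hs =>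
    (Finset.single_le_sum (f := fun i => γ' s i ^ 2) (fun i _ => sq_nonneg _)
      (Finset.mem_erase.2 ⟨hne, Finset.mem_univ _⟩)).trans_lt (ht s hs)
  have key := sq_sub_le_sq_sub_of_sq_deriv_lt one_pos (hcoord 0) (hcoord 1) hlt
  simp only [h0, h1, hne, if_true, if_false] at key
  -- The increments differ in square by `2 + 2 * cosh (a + b)`.
  have hcosh := Real.cosh_pos (a + b)
  rw [Real.cosh_add] at hcosh
  linarith [Real.cosh_sq a, Real.cosh_sq b]
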